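/- There is an absolute constant C > 0 such that for all reals x ≥ 2, N, R with 1 ≤ N ≤ R ≤ x, and every nonzero integer a with |a| < x/N, one has | Σ_{x/N < q ≤ x} ρ_R*(x;q,a) − x · Σ_{s ≤ N, gcd(s,a)=1} (1/φ(s))·(1 − s/N) | ≤ C·( RN + |a|·log 2N ), where q runs over positive integers and s over positive integers coprime to a. -/

import Mathlib

open Finset Real

/-- Vaughan's function `F_R(n) = ∑_{r ≤ R} μ(r)² μ((r,n)) φ((r,n)) / φ(r)`. -/
noncomputable def FR (R : ℝ) (n : ℤ) : ℝ :=
  ∑ r ∈ Finset.Icc 1 ⌊R⌋₊,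
    (ArithmeticFunction.moebius r : ℝ) ^ 2 *
      (ArithmeticFunction.moebius (Int.gcd (r : ℤ) n) : ℝ) *
      (Nat.totient (Int.gcd (r : ℤ) n) : ℝ) / (Nat.totient r : ℝ)

/-- `ρ_R^*(x;q,a) = ∑_{n ≤ x, n ≡ a (q), n > a} F_R(n)`. -/
noncomputable def rhoStar (R x : ℝ) (q : ℕ) (a : ℤ) : ℝ :=
  ∑ n ∈ (Finset.Icc 1 ⌊x⌋₊).filter (fun n : ℕ => a < (n : ℤ) ∧ (q : ℤ) ∣ (n : ℤ) - a),
    FR R n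

/-- `ψ^*(x;q,a) = ∑_{n ≤ x, n ≡ a (q), n > a} Λ(n)`. -/
noncomputable def psiStar (x : ℝ) (q : ℕ) (a : ℤ) : ℝ :=
  ∑ n ∈ (Finset.Icc 1 ⌊x⌋₊).filter (fun n : ℕ => a < (n : ℤ) ∧ (q : ℤ) ∣ (n : ℤ) - a),
    ArithmeticFunction.vonMangoldt n

/-- The multiplicative function `d ↦ (d, s) · 1_{(d, s) ∣ a}`; the congruence `d ∣ a + s q` in `q`
has density `gcdWeight s a d / d`. -/
noncomputable def gcdWeight (s : ℕ) (a : ℤ) : ArithmeticFunction ℝ :=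
  ⟨fun d => if d = 0 then 0 else if ((d.gcd s : ℕ) : ℤ) ∣ a then (d.gcd s : ℝ) else 0, by simp⟩

lemma gcdWeight_apply {s d : ℕ} (a : ℤ) (hd : d ≠ 0) :
    gcdWeight s a d = if ((d.gcd s : ℕ) : ℤ) ∣ a then (d.gcd s : ℝ) else 0 := by
  simp [gcdWeight, hd]

lemma gcdWeight_isMultiplicative (s : ℕ) (a : ℤ) : (gcdWeight s a).IsMultiplicative := by
  rw [ArithmeticFunction.IsMultiplicative.iff_ne_zero]
  refine ⟨by simp [gcdWeight], fun {m n} hm hn hmn => ?_⟩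
  have h1 : (m * n).gcd s = m.gcd s * n.gcd s := by
    rw [Nat.gcd_comm, Nat.Coprime.gcd_mul s hmn, Nat.gcd_comm s, Nat.gcd_comm s]
  have h2 : (m.gcd s).Coprime (n.gcd s) :=
    Nat.Coprime.coprime_dvd_left (Nat.gcd_dvd_left _ _)
      (Nat.Coprime.coprime_dvd_right (Nat.gcd_dvd_left _ _) hmn)
  have h3 : (((m * n).gcd s : ℕ) : ℤ) ∣ a ↔ ((m.gcd s : ℕ) : ℤ) ∣ a ∧ ((n.gcd s : ℕ) : ℤ) ∣ a := by
    simp only [Int.natCast_dvd]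
    rw [h1]
    exact ⟨fun h => ⟨dvd_of_mul_right_dvd h, dvd_of_mul_left_dvd h⟩,
      fun h => h2.mul_dvd_of_dvd_of_dvd h.1 h.2⟩
  rw [gcdWeight_apply a hm, gcdWeight_apply a hn, gcdWeight_apply a (mul_ne_zero hm hn),
    if_congr h3 rfl rfl]
  by_cases ha : ((m.gcd s : ℕ) : ℤ) ∣ a <;> by_cases hb : ((n.gcd s : ℕ) : ℤ) ∣ a <;>
    simp [ha, hb, h1]

lemma gcdWeight_prime_of_not_dvd {s p : ℕ} (a : ℤ) (hp : p.Prime) (h : ¬ p ∣ s) :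
    gcdWeight s a p = 1 := by
  have : p.gcd s = 1 := (Nat.Prime.coprime_iff_not_dvd hp).2 h
  simp [gcdWeight_apply a hp.ne_zero, this]

lemma gcdWeight_of_dvd {s d : ℕ} (a : ℤ) (hd : d ≠ 0) (h : d ∣ s) :
    gcdWeight s a d = if (d : ℤ) ∣ a then (d : ℝ) else 0 := by
  rw [gcdWeight_apply a hd, Nat.gcd_eq_left h]

lemma totient_eq_prod_of_squarefree {r : ℕ} (hr : Squarefree r) :
    (r.totient : ℝ) = ∏ p ∈ r.primeFactors, ((p : ℝ) - 1) := by
  have h := Nat.totient_mul_prod_primeFactors r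
  rw [Nat.prod_primeFactors_of_squarefree hr, mul_comm] at h
  rw [Nat.eq_of_mul_eq_mul_left (Nat.pos_of_ne_zero hr.ne_zero) h, Nat.cast_prod]
  refine prod_congr rfl fun p hp => ?_
  rw [Nat.cast_sub (Nat.prime_of_mem_primeFactors hp).one_le, Nat.cast_one]

lemma moebius_mul_totient_gcd {r : ℕ} (hr : Squarefree r) (n : ℤ) :
    (ArithmeticFunction.moebius (Int.gcd (r : ℤ) n) : ℝ) * (Nat.totient (Int.gcd (r : ℤ) n) : ℝ)
      = ∑ d ∈ r.divisors, (ArithmeticFunction.moebius d : ℝ) * if (d : ℤ) ∣ n then (d : ℝ) else 0 := by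
  have h0 : ∑ d ∈ r.divisors, (ArithmeticFunction.moebius d : ℝ) * (if (d : ℤ) ∣ n then (d : ℝ) else 0)
      = ∑ d ∈ r.divisors, (ArithmeticFunction.moebius d : ℝ) * gcdWeight 0 n d := by
    refine sum_congr rfl fun d hd => ?_
    rw [gcdWeight_of_dvd n (Nat.pos_of_mem_divisors hd).ne' (dvd_zero d)]
  rw [h0, ← (gcdWeight_isMultiplicative 0 n).prodPrimeFactors_one_sub_of_squarefree _ hr]
  set g := Int.gcd (r : ℤ) n with hg
  have hgr : g ∣ r := Int.natCast_dvd_natCast.1 (Int.gcd_dvd_left ..)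
  have hgs : Squarefree g := hr.squarefree_of_dvd hgr
  have hmu : (ArithmeticFunction.moebius g : ℝ) = ∏ p ∈ g.primeFactors, (-1 : ℝ) := by
    rw [← ArithmeticFunction.isMultiplicative_moebius.prod_primeFactors hgs, Int.cast_prod]
    refine prod_congr rfl fun p hp => ?_
    rw [ArithmeticFunction.moebius_apply_prime (Nat.prime_of_mem_primeFactors hp)]
    simp
  rw [hmu, totient_eq_prod_of_squarefree hgs, ← prod_mul_distrib]
  refine prod_subset_one_on_sdiff (Nat.primeFactors_mono hgr hr.ne_zero) (fun p hp => ?_)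
    (fun p hp => ?_)
  · rw [mem_sdiff] at hp
    have hpp := Nat.prime_of_mem_primeFactors hp.1
    rw [gcdWeight_of_dvd n hpp.ne_zero (dvd_zero p), if_neg, sub_zero]
    intro h
    refine hp.2 (Nat.mem_primeFactors.2 ⟨hpp, ?_, hgs.ne_zero⟩)
    exact Int.natCast_dvd_natCast.1
      (Int.dvd_coe_gcd (Int.natCast_dvd_natCast.2 (Nat.dvd_of_mem_primeFactors hp.1)) h)
  · have hpp := Nat.prime_of_mem_primeFactors hp
    rw [gcdWeight_of_dvd n hpp.ne_zero (dvd_zero p), if_pos]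
    · ring
    · exact (Int.natCast_dvd_natCast.2 (Nat.dvd_of_mem_primeFactors hp)).trans
        (Int.gcd_dvd_right ..)

lemma sum_squarefree_divisors_prod (g : ℕ → ℝ) {n : ℕ} (hn : n ≠ 0) :
    ∑ d ∈ n.divisors with Squarefree d, ∏ p ∈ d.primeFactors, g p
      = ∏ p ∈ n.primeFactors, (1 + g p) := by
  rw [prod_one_add]
  refine sum_nbij' (fun d => d.primeFactors) (fun t => ∏ p ∈ t, p) ?_ ?_ ?_ ?_ ?_
  · intro d hd
    simp only [mem_filter, Nat.mem_divisors] at hd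
    exact mem_powerset.2 (Nat.primeFactors_mono hd.1.1 hn)
  · intro t ht
    rw [mem_powerset] at ht
    have hp : ∀ p ∈ t, p.Prime := fun p h => Nat.prime_of_mem_primeFactors (ht h)
    simp only [mem_filter, Nat.mem_divisors]
    refine ⟨⟨(prod_dvd_prod_of_subset _ _ _ ht).trans (Nat.prod_primeFactors_dvd n), hn⟩, ?_⟩
    exact Finset.squarefree_prod_of_pairwise_isCoprime (fun p hpt q hqt hpq =>
      Nat.coprime_iff_isRelPrime.1 <| (Nat.coprime_primes (hp p hpt) (hp q hqt)).2 hpq)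
      fun p h => (hp p h).squarefree
  · intro d hd
    simp only [mem_filter] at hd
    exact Nat.prod_primeFactors_of_squarefree hd.2
  · intro t ht
    rw [mem_powerset] at ht
    exact Nat.primeFactors_prod fun p h => Nat.prime_of_mem_primeFactors (ht h)
  · intros; rfl

lemma abs_card_dvd_add_mul_sub_le (s d : ℕ) (hd : d ≠ 0) (a : ℤ) (A B : ℕ) :
    |(#((Ioc A B).filter fun q : ℕ => (d : ℤ) ∣ a + (s : ℤ) * (q : ℤ)) : ℝ)
      - ((B - A : ℕ) : ℝ) * (gcdWeight s a d / d)| ≤ 1 := by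
  have hd' : (0 : ℝ) < d := by positivity
  rw [gcdWeight_apply a hd]
  set g := d.gcd s with hg
  have hg0 : 0 < g := Nat.gcd_pos_of_pos_left _ (Nat.pos_of_ne_zero hd)
  split_ifs with h
  · obtain ⟨e, he⟩ : g ∣ d := Nat.gcd_dvd_left _ _
    obtain ⟨u, v, huv⟩ : ∃ u v : ℤ, a = d * u + s * v := by
      obtain ⟨k, hk⟩ := h
      refine ⟨d.gcdA s * k, d.gcdB s * k, ?_⟩
      rw [hk, hg, Nat.gcd_eq_gcd_ab]; ring
    have he0 : 0 < e := Nat.pos_of_ne_zero (by rintro rfl; exact hd (by rw [he, mul_zero]))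
    have hco : IsCoprime (e : ℤ) ((s / g : ℕ) : ℤ) := by
      rw [Nat.isCoprime_iff_coprime]
      have := Nat.coprime_div_gcd_div_gcd (m := d) (n := s) hg0
      rwa [← hg, he, Nat.mul_div_cancel_left _ hg0] at this
    have hsg : (s : ℤ) = g * ((s / g : ℕ) : ℤ) := by
      exact_mod_cast (Nat.mul_div_cancel' (Nat.gcd_dvd_right d s)).symm
    have key : ∀ q : ℤ, (d : ℤ) ∣ a + s * q ↔ q ≡ -v [ZMOD e] := by
      intro q
      have : a + s * q = d * u + g * (((s / g : ℕ) : ℤ) * (q + v)) := by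
        rw [huv, hsg]; ring
      rw [this, dvd_add_right (dvd_mul_right _ _), Int.modEq_comm, Int.modEq_iff_dvd, he, Nat.cast_mul,
        mul_dvd_mul_iff_left (by exact_mod_cast hg0.ne'), sub_neg_eq_add]
      exact ⟨fun h => hco.dvd_of_dvd_mul_left h, fun h => h.mul_left _⟩
    have hcard : #((Ioc A B).filter fun q : ℕ => (d : ℤ) ∣ a + (s : ℤ) * (q : ℤ))
        = #{x ∈ Ioc (A : ℤ) (B : ℤ) | x ≡ -v [ZMOD e]} := by
      refine card_nbij' (fun q => (q : ℤ)) Int.toNat ?_ ?_ ?_ ?_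
      · intro q hq
        simp only [coe_filter, mem_Ioc, Set.mem_ofPred_eq] at hq ⊢
        exact ⟨by exact_mod_cast hq.1, (key q).1 hq.2⟩
      · intro q hq
        simp only [coe_filter, mem_Ioc, Set.mem_ofPred_eq] at hq ⊢
        refine ⟨by omega, ?_⟩
        rw [Int.toNat_of_nonneg (by omega)]
        exact (key q).2 hq.2
      · intro q _; simp
      · intro q hq
        simp only [coe_filter, mem_Ioc, Set.mem_ofPred_eq] at hq
        exact Int.toNat_of_nonneg (by omega)
    have hZ := Int.Ioc_filter_modEq_card (A : ℤ) (B : ℤ) (r := (e : ℤ)) (by exact_mod_cast he0) (-v)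
    rw [hcard]
    have hge : (g : ℝ) / d = 1 / e := by
      rw [he]; push_cast; field_simp
    rw [hge]
    set c := #{x ∈ Ioc (A : ℤ) (B : ℤ) | x ≡ -v [ZMOD e]} with hc
    have heR : (0 : ℝ) < e := by exact_mod_cast he0
    rcases le_total A B with hAB | hAB
    · set X : ℚ := ((B : ℤ) - (-v : ℤ) : ℚ) / (e : ℤ) with hX
      set Y : ℚ := ((A : ℤ) - (-v : ℤ) : ℚ) / (e : ℤ) with hY
      have heQ : (0 : ℚ) < e := by exact_mod_cast he0
      have hXY : Y ≤ X := by
        rw [hX, hY]; push_cast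
        gcongr
      rw [max_eq_left (sub_nonneg.2 (Int.floor_le_floor hXY))] at hZ
      have hd1 : X - Y = ((B : ℚ) - A) * (1 / e) := by
        rw [hX, hY]; push_cast; ring
      have hcQ : (c : ℚ) = (⌊X⌋ : ℚ) - ⌊Y⌋ := by exact_mod_cast hZ
      have : |(c : ℚ) - ((B : ℚ) - A) * (1 / e)| ≤ 1 := by
        rw [← hd1, hcQ, abs_le]
        have := Int.floor_le X; have := Int.lt_floor_add_one X
        have := Int.floor_le Y; have := Int.lt_floor_add_one Y
        constructor <;> linarith
      rw [Nat.cast_sub hAB]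
      have h' : ((|(c : ℚ) - ((B : ℚ) - A) * (1 / e)| : ℚ) : ℝ) ≤ ((1 : ℚ) : ℝ) :=
        Rat.cast_le.2 this
      push_cast at h'
      exact h'
    · have : c = 0 := by rw [hc, Ioc_eq_empty (by omega)]; simp
      rw [this, Nat.sub_eq_zero_of_le hAB]; simp
  · have : #((Ioc A B).filter fun q : ℕ => (d : ℤ) ∣ a + (s : ℤ) * (q : ℤ)) = 0 := by
      rw [card_eq_zero, filter_eq_empty_iff]
      intro q _ hq
      apply h
      have h1 : (g : ℤ) ∣ a + s * q := dvd_trans (by exact_mod_cast Nat.gcd_dvd_left d s) hq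
      have h2 : (g : ℤ) ∣ s * q := dvd_mul_of_dvd_left (by exact_mod_cast Nat.gcd_dvd_right d s) _
      exact (Int.dvd_add_left h2).1 h1
    rw [this]; simp

lemma sum_mul_sum_divisors (M : ℕ) (w f : ℕ → ℝ) :
    ∑ n ∈ Icc 1 M, w n * ∑ d ∈ n.divisors, f d
      = ∑ d ∈ Icc 1 M, f d * ∑ m ∈ Icc 1 (M / d), w (d * m) := by
  simp only [mul_sum]
  rw [sum_sigma', sum_sigma']
  refine sum_bij' (fun x _ => ⟨x.2, x.1 / x.2⟩) (fun x _ => ⟨x.1 * x.2, x.1⟩) ?_ ?_ ?_ ?_ ?_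
  · rintro ⟨n, d⟩ h
    simp only [mem_sigma, mem_Icc, Nat.mem_divisors] at h ⊢
    have hd : 0 < d := Nat.pos_of_dvd_of_pos h.2.1 h.1.1
    have hdn : d ≤ n := Nat.le_of_dvd h.1.1 h.2.1
    exact ⟨⟨hd, hdn.trans h.1.2⟩, Nat.div_pos hdn hd, Nat.div_le_div_right h.1.2⟩
  · rintro ⟨d, m⟩ h
    simp only [mem_sigma, mem_Icc, Nat.mem_divisors] at h ⊢
    have hdm : 0 < d * m := Nat.mul_pos h.1.1 h.2.1
    refine ⟨⟨hdm, ?_⟩, dvd_mul_right _ _, hdm.ne'⟩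
    rw [mul_comm]
    exact (Nat.le_div_iff_mul_le h.1.1).1 h.2.2
  · rintro ⟨n, d⟩ h
    simp only [mem_sigma, mem_Icc, Nat.mem_divisors] at h ⊢
    rw [Nat.mul_div_cancel' h.2.1]
  · rintro ⟨d, m⟩ h
    simp only [mem_sigma, mem_Icc] at h ⊢
    rw [Nat.mul_div_cancel_left _ h.1.1]
  · rintro ⟨n, d⟩ h
    simp only [mem_sigma, mem_Icc, Nat.mem_divisors] at h ⊢
    rw [Nat.mul_div_cancel' h.2.1, mul_comm]

lemma prod_le_nine_mul_sum_divisors {n : ℕ} (hn : n ≠ 0) :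
    ∏ p ∈ n.primeFactors, ((1 + (p : ℝ)) / ((p : ℝ) - 1)) ≤ 9 * ∑ d ∈ n.divisors, 1 / √(d : ℝ) := by
  set c : ℕ → ℝ := fun p => if p = 2 then 3 else if p = 3 then 2 else if p = 5 then 3 / 2 else 1
  have hc1 : ∀ p, 1 ≤ c p := by
    intro p; simp only [c]; split_ifs <;> norm_num
  have hle : ∀ p ∈ n.primeFactors,
      (1 + (p : ℝ)) / ((p : ℝ) - 1) ≤ c p * (1 + 1 / √(p : ℝ)) := by
    intro p hp
    have hpp := Nat.prime_of_mem_primeFactors hp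
    have hs : (0 : ℝ) ≤ 1 / √(p : ℝ) := by positivity
    have h2 : 2 ≤ p := hpp.two_le
    by_cases h7 : 7 ≤ p
    · have hc : c p = 1 := by
        simp only [c]; rw [if_neg (by omega), if_neg (by omega), if_neg (by omega)]
      have hp7 : (7 : ℝ) ≤ p := by exact_mod_cast h7
      have hsq : √(p : ℝ) ^ 2 = p := Real.sq_sqrt (by positivity)
      have hsp : 0 < √(p : ℝ) := Real.sqrt_pos.2 (by positivity)
      have h5 : (5 / 2 : ℝ) ≤ √(p : ℝ) := Real.le_sqrt_of_sq_le (by norm_num; linarith)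
      rw [hc, one_mul, div_le_iff₀ (by linarith)]
      have : 2 ≤ 1 / √(p : ℝ) * ((p : ℝ) - 1) := by
        rw [one_div, inv_mul_eq_div, le_div_iff₀ hsp]
        nlinarith
      nlinarith
    · have : p = 2 ∨ p = 3 ∨ p = 5 := by
        interval_cases p <;> simp_all +decide
      rcases this with rfl | rfl | rfl <;> simp only [c] <;> norm_num at hs ⊢
  have hcprod : ∏ p ∈ n.primeFactors, c p ≤ 9 := by
    calc ∏ p ∈ n.primeFactors, c p ≤ ∏ p ∈ n.primeFactors ∪ {2, 3, 5}, c p := by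
          rw [← prod_sdiff (subset_union_left (s₁ := n.primeFactors) (s₂ := {2, 3, 5}))]
          exact le_mul_of_one_le_left (prod_nonneg fun p _ => zero_le_one.trans (hc1 p))
            (Finset.one_le_prod fun p _ => hc1 p)
      _ = ∏ p ∈ ({2, 3, 5} : Finset ℕ), c p := by
          refine (prod_subset subset_union_right fun p _ hp => ?_).symm
          simp only [mem_insert, mem_singleton, not_or] at hp
          simp [c, hp]
      _ ≤ 9 := by simp [c]; norm_num
  calc ∏ p ∈ n.primeFactors, ((1 + (p : ℝ)) / ((p : ℝ) - 1))
      ≤ ∏ p ∈ n.primeFactors, c p * (1 + 1 / √(p : ℝ)) := by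
        refine prod_le_prod (fun p hp => ?_) hle
        have : (1 : ℝ) ≤ p := by exact_mod_cast (Nat.prime_of_mem_primeFactors hp).one_le
        exact div_nonneg (by linarith) (by linarith)
    _ = (∏ p ∈ n.primeFactors, c p) * ∏ p ∈ n.primeFactors, (1 + 1 / √(p : ℝ)) := prod_mul_distrib
    _ ≤ 9 * ∏ p ∈ n.primeFactors, (1 + 1 / √(p : ℝ)) := by
        gcongr
    _ ≤ 9 * ∑ d ∈ n.divisors, 1 / √(d : ℝ) := by
        gcongr
        rw [← sum_squarefree_divisors_prod _ hn]
        calc _ = ∑ d ∈ n.divisors with Squarefree d, 1 / √(d : ℝ) := by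
              refine sum_congr rfl fun d hd => ?_
              rw [mem_filter] at hd
              rw [prod_div_distrib, prod_const_one, ← Real.sqrt_prod _ (fun _ _ => by positivity),
                ← Nat.cast_prod, Nat.prod_primeFactors_of_squarefree hd.2]
          _ ≤ _ := sum_le_sum_of_subset_of_nonneg (filter_subset _ _) fun _ _ _ => by positivity

lemma exists_weighted_divisor_sum_le :
    ∃ Z : ℝ, 0 < Z ∧ ∀ (M : ℕ) (w : ℕ → ℝ) (W : ℝ), 0 ≤ W →
      (∀ d ∈ Icc 1 M, ∑ m ∈ Icc 1 (M / d), w (d * m) ≤ W / d) →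
      ∑ n ∈ Icc 1 M, w n * ∑ d ∈ n.divisors, 1 / √(d : ℝ) ≤ Z * W := by
  have hsum : Summable fun n : ℕ => 1 / (n : ℝ) ^ (3 / 2 : ℝ) :=
    Real.summable_one_div_nat_rpow.2 (by norm_num)
  refine ⟨(∑' n : ℕ, 1 / (n : ℝ) ^ (3 / 2 : ℝ)) + 1,
    add_pos_of_nonneg_of_pos (tsum_nonneg fun n => by positivity) one_pos, fun M w W hW h => ?_⟩
  rw [sum_mul_sum_divisors]
  calc ∑ d ∈ Icc 1 M, 1 / √(d : ℝ) * ∑ m ∈ Icc 1 (M / d), w (d * m)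
      ≤ ∑ d ∈ Icc 1 M, 1 / √(d : ℝ) * (W / d) :=
        sum_le_sum fun d hd => mul_le_mul_of_nonneg_left (h d hd) (by positivity)
    _ = (∑ d ∈ Icc 1 M, 1 / (d : ℝ) ^ (3 / 2 : ℝ)) * W := by
        rw [sum_mul]
        refine sum_congr rfl fun d hd => ?_
        have hd0 : (0 : ℝ) < d := by exact_mod_cast (mem_Icc.1 hd).1
        rw [show (3 / 2 : ℝ) = 1 / 2 + 1 by norm_num, Real.rpow_add_one hd0.ne', ← Real.sqrt_eq_rpow]
        have := Real.sqrt_pos.2 hd0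
        field_simp
    _ ≤ _ := by
        gcongr
        linarith [hsum.sum_le_tsum (Icc 1 M) fun n _ => by positivity]

lemma div_totient_eq_prod {n : ℕ} (hn : n ≠ 0) :
    (n : ℝ) / n.totient = ∏ p ∈ n.primeFactors, ((p : ℝ) / ((p : ℝ) - 1)) := by
  have h := congrArg (Nat.cast (R := ℝ)) (Nat.totient_mul_prod_primeFactors n)
  have h1 : ((∏ p ∈ n.primeFactors, (p - 1) : ℕ) : ℝ) = ∏ p ∈ n.primeFactors, ((p : ℝ) - 1) := by
    rw [Nat.cast_prod]
    exact prod_congr rfl fun p hp => by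
      rw [Nat.cast_sub (Nat.prime_of_mem_primeFactors hp).one_le, Nat.cast_one]
  rw [Nat.cast_mul, Nat.cast_mul, h1, Nat.cast_prod] at h
  have h2 : (n.totient : ℝ) ≠ 0 := by
    exact_mod_cast (Nat.totient_pos.2 (Nat.pos_of_ne_zero hn)).ne'
  have h3 : ∏ p ∈ n.primeFactors, ((p : ℝ) - 1) ≠ 0 := prod_ne_zero_iff.2 fun p hp => by
    have : (1 : ℝ) < p := by exact_mod_cast (Nat.prime_of_mem_primeFactors hp).one_lt
    linarith
  rw [prod_div_distrib, div_eq_div_iff h2 h3, ← h, mul_comm]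

lemma exists_sum_one_div_totient_le :
    ∃ C : ℝ, 0 < C ∧ ∀ N : ℝ, 1 ≤ N →
      ∑ s ∈ Icc 1 ⌊N⌋₊, 1 / (s.totient : ℝ) ≤ C * Real.log (2 * N) := by
  obtain ⟨Z, hZ, h⟩ := exists_weighted_divisor_sum_le
  have hl2 : 0 < Real.log 2 := Real.log_pos (by norm_num)
  refine ⟨9 * Z / Real.log 2, by positivity, fun N hN => ?_⟩
  set M := ⌊N⌋₊
  have hH : ∀ k ≤ M, ∑ m ∈ Icc 1 k, 1 / (m : ℝ) ≤ 1 + Real.log N := by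
    intro k hk
    have h1 := harmonic_floor_le_one_add_log N hN
    rw [harmonic_eq_sum_Icc] at h1
    push_cast at h1
    simp only [one_div]
    exact (sum_le_sum_of_subset_of_nonneg (Icc_subset_Icc_right hk)
      fun _ _ _ => by positivity).trans h1
  have hlN := Real.log_nonneg hN
  have key := h M (fun n => 1 / (n : ℝ)) (1 + Real.log N) (by linarith) (fun d hd => by
    have := hH (M / d) (Nat.div_le_self _ _)
    calc ∑ m ∈ Icc 1 (M / d), 1 / ((d * m : ℕ) : ℝ) = (∑ m ∈ Icc 1 (M / d), 1 / (m : ℝ)) / d := by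
          rw [sum_div]; refine sum_congr rfl fun m _ => ?_
          rw [Nat.cast_mul, div_div, mul_comm]
      _ ≤ _ := by gcongr)
  calc ∑ s ∈ Icc 1 M, 1 / (s.totient : ℝ)
      ≤ ∑ s ∈ Icc 1 M, 9 * (1 / (s : ℝ) * ∑ d ∈ s.divisors, 1 / √(d : ℝ)) := by
        refine sum_le_sum fun s hs => ?_
        have hs0 : s ≠ 0 := by have := (mem_Icc.1 hs).1; omega
        have hsR : (s : ℝ) ≠ 0 := by exact_mod_cast hs0
        have h1 : 1 / (s.totient : ℝ) = 1 / (s : ℝ) * ((s : ℝ) / s.totient) := by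
          field_simp
        rw [h1, mul_left_comm 9]
        refine mul_le_mul_of_nonneg_left (le_trans ?_ (prod_le_nine_mul_sum_divisors hs0))
          (by positivity)
        rw [div_totient_eq_prod hs0]
        have hp1 : ∀ p ∈ s.primeFactors, (1 : ℝ) ≤ p := fun p hp => by
          exact_mod_cast (Nat.prime_of_mem_primeFactors hp).one_le
        refine prod_le_prod (fun p hp => div_nonneg (by positivity) (by linarith [hp1 p hp]))
          fun p hp => div_le_div_of_nonneg_right (by linarith) (by linarith [hp1 p hp])
    _ ≤ 9 * (Z * (1 + Real.log N)) := by rw [← mul_sum]; gcongr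
    _ ≤ 9 * Z / Real.log 2 * Real.log (2 * N) := by
        rw [Real.log_mul (by norm_num) (by linarith), div_mul_eq_mul_div, le_div_iff₀ hl2]
        have : Real.log 2 ≤ 1 := by linarith [Real.log_two_lt_d9]
        have h3 : Real.log N * Real.log 2 ≤ Real.log N := by nlinarith
        have : 0 < 9 * Z := by positivity
        nlinarith

lemma exists_sum_sigma_div_totient_le :
    ∃ C : ℝ, 0 < C ∧ ∀ R : ℝ, 0 ≤ R →
      ∑ r ∈ Icc 1 ⌊R⌋₊ with Squarefree r, (∑ d ∈ r.divisors, (d : ℝ)) / r.totient ≤ C * R := by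
  obtain ⟨Z, hZ, h⟩ := exists_weighted_divisor_sum_le
  refine ⟨9 * Z, by positivity, fun R hR => ?_⟩
  set M := ⌊R⌋₊
  have key := h M (fun _ => 1) M (by positivity) (fun d _ => by
    simpa using Nat.cast_div_le)
  calc ∑ r ∈ Icc 1 M with Squarefree r, (∑ d ∈ r.divisors, (d : ℝ)) / r.totient
      ≤ ∑ r ∈ Icc 1 M with Squarefree r, 9 * (1 * ∑ d ∈ r.divisors, 1 / √(d : ℝ)) := by
        refine sum_le_sum fun r hr => ?_
        have hrs := (mem_filter.1 hr).2
        rw [one_mul, totient_eq_prod_of_squarefree hrs]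
        refine le_trans (le_of_eq ?_) (prod_le_nine_mul_sum_divisors hrs.ne_zero)
        rw [prod_div_distrib, ← sum_squarefree_divisors_prod _ hrs.ne_zero]
        congr 1
        rw [filter_true_of_mem fun d hd => hrs.squarefree_of_dvd (Nat.dvd_of_mem_divisors hd)]
        refine sum_congr rfl fun d hd => ?_
        rw [← Nat.cast_prod, Nat.prod_primeFactors_of_squarefree
          (hrs.squarefree_of_dvd (Nat.dvd_of_mem_divisors hd))]
    _ ≤ ∑ r ∈ Icc 1 M, 9 * (1 * ∑ d ∈ r.divisors, 1 / √(d : ℝ)) :=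
        sum_le_sum_of_subset_of_nonneg (filter_subset _ _) fun _ _ _ => by positivity
    _ ≤ 9 * (Z * M) := by rw [← mul_sum]; gcongr
    _ ≤ 9 * Z * R := by
        rw [mul_assoc]; gcongr; exact Nat.floor_le hR

/-- The mean value over `q` of `FR R (a + s * q)`. -/
noncomputable def meanFR (R : ℝ) (s : ℕ) (a : ℤ) : ℝ :=
  ∑ r ∈ Icc 1 ⌊R⌋₊ with Squarefree r,
    (∏ p ∈ r.primeFactors, (1 - gcdWeight s a p)) / r.totient

lemma FR_eq_sum_squarefree (R : ℝ) (n : ℤ) :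
    FR R n = ∑ r ∈ Icc 1 ⌊R⌋₊ with Squarefree r,
      (∑ d ∈ r.divisors, (ArithmeticFunction.moebius d : ℝ) * if (d : ℤ) ∣ n then (d : ℝ) else 0)
        / r.totient := by
  rw [FR, sum_filter]
  refine sum_congr rfl fun r _ => ?_
  split_ifs with hr
  · have h : (ArithmeticFunction.moebius r : ℝ) ^ 2 = 1 := by
      exact_mod_cast ArithmeticFunction.moebius_sq_eq_one_of_squarefree hr
    rw [h, one_mul, moebius_mul_totient_gcd hr]
  · rw [ArithmeticFunction.moebius_eq_zero_of_not_squarefree hr]; simp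

lemma abs_sum_FR_sub_le (R : ℝ) (s : ℕ) (a : ℤ) (A B : ℕ) :
    |∑ q ∈ Ioc A B, FR R (a + (s : ℤ) * (q : ℤ)) - ((B - A : ℕ) : ℝ) * meanFR R s a|
      ≤ ∑ r ∈ Icc 1 ⌊R⌋₊ with Squarefree r, (∑ d ∈ r.divisors, (d : ℝ)) / r.totient := by
  simp only [FR_eq_sum_squarefree, meanFR]
  rw [sum_comm, mul_sum, ← sum_sub_distrib]
  refine (abs_sum_le_sum_abs _ _).trans (sum_le_sum fun r hr => ?_)
  have hrs := (mem_filter.1 hr).2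
  rw [(gcdWeight_isMultiplicative s a).prodPrimeFactors_one_sub_of_squarefree _ hrs, ← sum_div,
    ← mul_div_assoc, ← sub_div, abs_div, Nat.abs_cast]
  gcongr
  rw [sum_comm, mul_sum, ← sum_sub_distrib]
  refine (abs_sum_le_sum_abs _ _).trans (sum_le_sum fun d hd => ?_)
  have hd0 : d ≠ 0 := (Nat.pos_of_mem_divisors hd).ne'
  have hdR : (d : ℝ) ≠ 0 := by exact_mod_cast hd0
  have hmu : |(ArithmeticFunction.moebius d : ℝ)| ≤ 1 := by
    exact_mod_cast ArithmeticFunction.abs_moebius_le_one (n := d)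
  have hc := abs_card_dvd_add_mul_sub_le s d hd0 a A B
  rw [← mul_sum, ← sum_filter, sum_const, nsmul_eq_mul]
  set c : ℝ := (#((Ioc A B).filter fun q : ℕ => (d : ℤ) ∣ a + (s : ℤ) * (q : ℤ)) : ℝ)
  have : (ArithmeticFunction.moebius d : ℝ) * (c * d)
      - ((B - A : ℕ) : ℝ) * ((ArithmeticFunction.moebius d : ℝ) * gcdWeight s a d)
      = (ArithmeticFunction.moebius d : ℝ) * d
        * (c - ((B - A : ℕ) : ℝ) * (gcdWeight s a d / d)) := by
    field_simp
  rw [this, abs_mul, abs_mul, Nat.abs_cast]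
  calc _ ≤ 1 * (d : ℝ) * 1 := by gcongr
    _ = d := by ring

lemma prod_one_sub_gcdWeight_eq_zero {r s : ℕ} (a : ℤ) (hr : Squarefree r) (h : ¬ r ∣ s) :
    ∏ p ∈ r.primeFactors, (1 - gcdWeight s a p) = 0 := by
  obtain ⟨p, hp, hps⟩ : ∃ p ∈ r.primeFactors, ¬ p ∣ s := by
    by_contra! hall
    refine h ?_
    rw [← Nat.prod_primeFactors_of_squarefree hr]
    exact prod_primes_dvd s (fun p hp => (Nat.prime_of_mem_primeFactors hp).prime) hall
  exact prod_eq_zero hp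
    (by rw [gcdWeight_prime_of_not_dvd a (Nat.prime_of_mem_primeFactors hp) hps, sub_self])

lemma meanFR_eq_sum_divisors (R : ℝ) {s : ℕ} (hs : s ≠ 0) (a : ℤ) :
    meanFR R s a = ∑ r ∈ s.divisors with Squarefree r, if r ≤ ⌊R⌋₊ then
      ∏ p ∈ r.primeFactors, ((1 - if (p : ℤ) ∣ a then (p : ℝ) else 0) / ((p : ℝ) - 1)) else 0 := by
  have h1 : meanFR R s a = ∑ r ∈ (Icc 1 ⌊R⌋₊ ∩ s.divisors).filter Squarefree,
      (∏ p ∈ r.primeFactors, (1 - gcdWeight s a p)) / r.totient := by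
    refine (sum_subset (filter_subset_filter _ inter_subset_left) fun r hr hr' => ?_).symm
    simp only [mem_filter, mem_inter, Nat.mem_divisors, not_and] at hr hr'
    rw [prod_one_sub_gcdWeight_eq_zero a hr.2 (fun h => hr' ⟨hr.1, h, hs⟩ hr.2), zero_div]
  rw [h1, ← sum_filter]
  refine sum_congr ?_ fun r hr => ?_
  · ext r
    simp only [mem_filter, mem_inter, Nat.mem_divisors, mem_Icc]
    constructor
    · rintro ⟨⟨h1, h2⟩, h3⟩
      exact ⟨⟨h2, h3⟩, h1.2⟩
    · rintro ⟨⟨h1, h2⟩, h3⟩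
      exact ⟨⟨⟨Nat.pos_of_ne_zero h2.ne_zero, h3⟩, h1⟩, h2⟩
  · simp only [mem_filter, Nat.mem_divisors] at hr
    rw [totient_eq_prod_of_squarefree hr.1.2, prod_div_distrib]
    congr 1
    refine prod_congr rfl fun p hp => ?_
    rw [gcdWeight_of_dvd a (Nat.prime_of_mem_primeFactors hp).ne_zero
      ((Nat.dvd_of_mem_primeFactors hp).trans hr.1.1.1)]

lemma abs_meanFR_le (R : ℝ) {s : ℕ} (hs : s ≠ 0) (a : ℤ) : |meanFR R s a| ≤ s := by
  rw [meanFR_eq_sum_divisors R hs]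
  calc _ ≤ ∑ r ∈ s.divisors with Squarefree r, (1 : ℝ) := by
        refine (abs_sum_le_sum_abs _ _).trans (sum_le_sum fun r _ => ?_)
        split_ifs
        · rw [abs_prod]
          refine prod_le_one (fun _ _ => abs_nonneg _) fun p hp => ?_
          have hp2 : (2 : ℝ) ≤ p := by exact_mod_cast (Nat.prime_of_mem_primeFactors hp).two_le
          rw [abs_div, abs_of_pos (by linarith : (0 : ℝ) < (p : ℝ) - 1),
            div_le_one (by linarith), abs_le]
          split_ifs <;> constructor <;> linarith
        · simp
    _ ≤ ∑ r ∈ s.divisors, (1 : ℝ) :=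
        sum_le_sum_of_subset_of_nonneg (filter_subset _ _) fun _ _ _ => zero_le_one
    _ ≤ s := by
        simpa using Nat.card_divisors_le_self s

lemma meanFR_eq {R : ℝ} {s : ℕ} (hs : s ≠ 0) (hR : s ≤ ⌊R⌋₊) (a : ℤ) :
    meanFR R s a = if Int.gcd (s : ℤ) a = 1 then (s : ℝ) / s.totient else 0 := by
  have h1 : meanFR R s a = ∏ p ∈ s.primeFactors,
      (1 + (1 - if (p : ℤ) ∣ a then (p : ℝ) else 0) / ((p : ℝ) - 1)) := by
    rw [meanFR_eq_sum_divisors R hs, ← sum_squarefree_divisors_prod _ hs]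
    refine sum_congr rfl fun r hr => if_pos ?_
    exact (Nat.divisor_le (mem_filter.1 hr).1).trans hR
  have hp1 : ∀ p ∈ s.primeFactors, (0 : ℝ) < (p : ℝ) - 1 := fun p hp => by
    have : (1 : ℝ) < p := by exact_mod_cast (Nat.prime_of_mem_primeFactors hp).one_lt
    linarith
  rw [h1]
  split_ifs with hg
  · rw [div_totient_eq_prod hs]
    refine prod_congr rfl fun p hp => ?_
    have := hp1 p hp
    rw [if_neg]
    · field_simp; ring
    · intro hpa
      have h := Int.dvd_coe_gcd (Int.natCast_dvd_natCast.2 (Nat.dvd_of_mem_primeFactors hp)) hpa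
      rw [hg] at h
      exact (Nat.prime_of_mem_primeFactors hp).one_lt.ne'
        (Nat.dvd_one.1 (by exact_mod_cast h))
  · obtain ⟨p, hp, hpg⟩ := Nat.exists_prime_and_dvd hg
    have hps : p ∣ s := hpg.trans (Int.natCast_dvd_natCast.1 (Int.gcd_dvd_left ..))
    have hpa : (p : ℤ) ∣ a := (Int.natCast_dvd_natCast.2 hpg).trans (Int.gcd_dvd_right ..)
    have hmem : p ∈ s.primeFactors := Nat.mem_primeFactors.2 ⟨hp, hps, hs⟩
    have := hp1 p hmem
    refine prod_eq_zero hmem ?_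
    rw [if_pos hpa]
    field_simp; ring

lemma sum_rhoStar_eq {x N : ℝ} (R : ℝ) {a : ℤ} (hx : 0 < x) (hN : 1 ≤ N)
    (ha : |(a : ℝ)| < x / N) :
    ∑ q ∈ Ioc ⌊x / N⌋₊ ⌊x⌋₊, rhoStar R x q a
      = ∑ s ∈ Icc 1 (⌊N⌋₊ + 1), ∑ q ∈ Ioc ⌊x / N⌋₊ ⌊min x ((x - a) / s)⌋₊,
          FR R (a + (s : ℤ) * (q : ℤ)) := by
  have hN0 : 0 < N := by linarith
  have hxN : x / N ≤ x := div_le_self hx.le hN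
  have hq : ∀ q : ℕ, ⌊x / N⌋₊ < q → x / N < q := fun q h => (Nat.floor_lt' (by omega)).1 h
  have haZ : ∀ q : ℕ, x / N < q → |a| < (q : ℤ) := fun q h => by
    have : ((|a| : ℤ) : ℝ) < ((q : ℤ) : ℝ) := by push_cast; linarith
    exact_mod_cast this
  have hax := abs_lt.1 ha
  have h1 : ∀ q ∈ Ioc ⌊x / N⌋₊ ⌊x⌋₊, rhoStar R x q a
      = ∑ s ∈ Icc 1 (⌊N⌋₊ + 1), if (a : ℝ) + s * q ≤ x then FR R (a + (s : ℤ) * (q : ℤ)) else 0 := by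
    intro q hqm
    rw [mem_Ioc] at hqm
    have hqx := hq q hqm.1
    have haq := haZ q hqx
    have haq' := abs_lt.1 haq
    have hq0 : (0 : ℤ) < q := (abs_nonneg a).trans_lt haq
    have hqR : (0 : ℝ) < q := by exact_mod_cast hq0
    rw [rhoStar, ← sum_filter]
    refine sum_bij' (fun n _ => (((n : ℤ) - a) / (q : ℤ)).toNat)
      (fun s _ => (a + (s : ℤ) * (q : ℤ)).toNat) ?_ ?_ ?_ ?_ ?_
    · intro n hn
      simp only [mem_filter, mem_Icc] at hn ⊢
      obtain ⟨⟨hn1, hn2⟩, han, k, hk⟩ := hn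
      have hk0 : 0 < k := by
        by_contra! hk0
        nlinarith
      have hnx : (n : ℝ) ≤ x := (Nat.le_floor_iff hx.le).1 hn2
      lift k to ℕ using hk0.le
      rw [hk, Int.mul_ediv_cancel_left _ hq0.ne', Int.toNat_natCast]
      have hkR : (n : ℝ) - a = q * k := by exact_mod_cast hk
      refine ⟨⟨by exact_mod_cast hk0, ?_⟩, by linarith⟩
      have hk1 : (k : ℝ) < N + 1 := by
        by_contra! hcon
        have : x / N * (N + 1) < q * k := by
          calc x / N * (N + 1) < q * (N + 1) := by gcongr
            _ ≤ q * k := by gcongr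
        rw [mul_add, div_mul_cancel₀ _ hN0.ne', mul_one] at this
        linarith
      have hk2 : (k : ℝ) - 1 < N := by linarith
      have := Nat.lt_floor_add_one N
      have h3 : (k : ℝ) < ((⌊N⌋₊ + 2 : ℕ) : ℝ) := by push_cast; linarith
      have : k < ⌊N⌋₊ + 2 := by exact_mod_cast h3
      omega
    · intro s hs
      simp only [mem_filter, mem_Icc] at hs ⊢
      have hs1 : (1 : ℤ) ≤ s := by exact_mod_cast hs.1.1
      have hpos : 0 < a + (s : ℤ) * q := by nlinarith
      have hcast : ((a + (s : ℤ) * (q : ℤ)).toNat : ℤ) = a + (s : ℤ) * (q : ℤ) :=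
        Int.toNat_of_nonneg hpos.le
      have hcastR : ((a + (s : ℤ) * (q : ℤ)).toNat : ℝ) = (a : ℝ) + s * q := by exact_mod_cast hcast
      refine ⟨⟨by omega, ?_⟩, ?_, ?_⟩
      · rw [Nat.le_floor_iff hx.le, hcastR]
        exact hs.2
      · rw [hcast]; nlinarith
      · rw [hcast]; exact ⟨s, by ring⟩
    · intro n hn
      simp only [mem_filter, mem_Icc] at hn
      obtain ⟨⟨hn1, hn2⟩, han, hdvd⟩ := hn
      have : 0 ≤ ((n : ℤ) - a) / (q : ℤ) := Int.ediv_nonneg (by omega) hq0.le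
      rw [Int.toNat_of_nonneg this, Int.ediv_mul_cancel hdvd]
      simp
    · intro s hs
      simp only [mem_filter, mem_Icc] at hs
      have hs1 : (1 : ℤ) ≤ s := by exact_mod_cast hs.1.1
      have hpos : 0 < a + (s : ℤ) * q := by nlinarith
      rw [Int.toNat_of_nonneg hpos.le, add_sub_cancel_left, Int.mul_ediv_cancel _ hq0.ne',
        Int.toNat_natCast]
    · intro n hn
      simp only [mem_filter, mem_Icc] at hn
      obtain ⟨⟨hn1, hn2⟩, han, hdvd⟩ := hn
      have : 0 ≤ ((n : ℤ) - a) / (q : ℤ) := Int.ediv_nonneg (by omega) hq0.le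
      rw [Int.toNat_of_nonneg this, Int.ediv_mul_cancel hdvd]
      simp
  rw [sum_congr rfl h1, sum_comm]
  refine sum_congr rfl fun s hs => ?_
  have hs0 : (0 : ℝ) < s := by exact_mod_cast (mem_Icc.1 hs).1
  rw [← sum_filter]
  refine sum_congr ?_ fun _ _ => rfl
  have hmin : 0 ≤ min x ((x - a) / s) := le_min hx.le (div_nonneg (by linarith) hs0.le)
  ext q
  rw [mem_filter, mem_Ioc, mem_Ioc, Nat.le_floor_iff hmin, Nat.le_floor_iff hx.le, le_min_iff,
    le_div_iff₀ hs0, and_assoc, mul_comm (s : ℝ)]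
  constructor
  · rintro ⟨h1, h2, h3⟩; exact ⟨h1, h2, by linarith⟩
  · rintro ⟨h1, h2, h3⟩; exact ⟨h1, h2, by linarith⟩

lemma abs_length_sub_le {x N : ℝ} {a : ℤ} {s : ℕ} (hx : 0 < x) (hN : 1 ≤ N)
    (ha : |(a : ℝ)| < x / N) (hs : 1 ≤ s) :
    |((⌊min x ((x - a) / s)⌋₊ - ⌊x / N⌋₊ : ℕ) : ℝ) - max (x / s - x / N) 0|
      ≤ 1 + |(a : ℝ)| / s := by
  have hxN : x / N ≤ x := div_le_self hx.le hN
  have hax := abs_lt.1 ha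
  have hs1 : (1 : ℝ) ≤ s := by exact_mod_cast hs
  have hmin : 0 ≤ min x ((x - a) / s) := le_min hx.le (div_nonneg (by linarith) (by linarith))
  have hcast : ∀ m n : ℕ, ((m - n : ℕ) : ℝ) = max ((m : ℝ) - n) 0 := fun m n => by
    rcases le_total n m with h | h
    · rw [Nat.cast_sub h, max_eq_left (sub_nonneg.2 (by exact_mod_cast h))]
    · rw [Nat.sub_eq_zero_of_le h, max_eq_right (sub_nonpos.2 (by exact_mod_cast h)), Nat.cast_zero]
  rw [hcast]
  refine (abs_max_sub_max_le_abs _ _ _).trans ?_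
  have h1 : |min x ((x - a) / s) - x / s| ≤ |(a : ℝ)| / s := by
    have hxs : x / s = min x (x / s) := (min_eq_right (div_le_self hx.le hs1)).symm
    calc |min x ((x - a) / s) - x / s| = |min x ((x - a) / s) - min x (x / s)| := by rw [← hxs]
      _ ≤ max |x - x| |(x - a) / s - x / s| := abs_min_sub_min_le_max _ _ _ _
      _ = |(a : ℝ)| / s := by
          rw [← sub_div, sub_self, abs_zero, sub_sub_cancel_left, abs_div, abs_neg, Nat.abs_cast]
          exact max_eq_right (by positivity)
  have h2 := Nat.floor_le hmin
  have h3 := Nat.lt_floor_add_one (min x ((x - a) / s))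
  have h4 := Nat.floor_le (show 0 ≤ x / N by positivity)
  have h5 := Nat.lt_floor_add_one (x / N)
  have h6 := abs_le.1 h1
  rw [abs_le]
  constructor <;> linarith

lemma mul_sum_one_sub_div_eq {x N R : ℝ} (a : ℤ) (hx : 0 < x) (hN : 1 ≤ N) (hNR : N ≤ R) :
    x * ∑ s ∈ (Icc 1 ⌊N⌋₊).filter (fun s : ℕ => Int.gcd (s : ℤ) a = 1),
        (1 / (Nat.totient s : ℝ)) * (1 - (s : ℝ) / N)
      = ∑ s ∈ Icc 1 (⌊N⌋₊ + 1), max (x / s - x / N) 0 * meanFR R s a := by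
  have hN0 : 0 < N := by linarith
  have htop : max (x / ((⌊N⌋₊ + 1 : ℕ) : ℝ) - x / N) 0 = 0 := by
    refine max_eq_right (sub_nonpos.2 ?_)
    gcongr
    push_cast
    exact (Nat.lt_floor_add_one N).le
  rw [sum_Icc_succ_top (by omega), htop, zero_mul, add_zero, sum_filter, mul_sum]
  refine sum_congr rfl fun s hs => ?_
  rw [mem_Icc] at hs
  have hs0 : s ≠ 0 := by omega
  have hsR : (0 : ℝ) < s := by exact_mod_cast hs.1
  have hsN : (s : ℝ) ≤ N := (Nat.le_floor_iff hN0.le).1 hs.2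
  have hphi : (0 : ℝ) < s.totient := by exact_mod_cast Nat.totient_pos.2 hs.1
  rw [meanFR_eq hs0 (hs.2.trans (Nat.floor_le_floor hNR)), max_eq_left (sub_nonneg.2 (by gcongr))]
  split_ifs
  · field_simp
  · simp

lemma sum_error_mul_abs_meanFR_le {N R C : ℝ} (a : ℤ) (hN : 1 ≤ N) (hNR : N ≤ R)
    (hC : ∑ s ∈ Icc 1 ⌊N⌋₊, 1 / (s.totient : ℝ) ≤ C) :
    ∑ s ∈ Icc 1 (⌊N⌋₊ + 1), (1 + |(a : ℝ)| / s) * |meanFR R s a|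
      ≤ 4 * (R * N) + |(a : ℝ)| * (C + 1) := by
  have hfl : (⌊N⌋₊ : ℝ) ≤ N := Nat.floor_le (by linarith)
  have h1 : ∑ s ∈ Icc 1 (⌊N⌋₊ + 1), |meanFR R s a| ≤ 4 * (R * N) := by
    calc _ ≤ ∑ s ∈ Icc 1 (⌊N⌋₊ + 1), (2 * N) := by
          refine sum_le_sum fun s hs => ?_
          rw [mem_Icc] at hs
          have : (s : ℝ) ≤ ⌊N⌋₊ + 1 := by exact_mod_cast hs.2
          linarith [abs_meanFR_le R (by omega : s ≠ 0) a]
      _ = ((⌊N⌋₊ : ℝ) + 1) * (2 * N) := by simp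
      _ ≤ (2 * N) * (2 * N) := by gcongr; linarith
      _ ≤ 4 * (R * N) := by nlinarith
  have h2 : ∑ s ∈ Icc 1 (⌊N⌋₊ + 1), |meanFR R s a| / s ≤ C + 1 := by
    rw [sum_Icc_succ_top (by omega)]
    refine add_le_add ((sum_le_sum fun s hs => ?_).trans hC) ?_
    · rw [mem_Icc] at hs
      have hs0 : (s : ℝ) ≠ 0 := by have := hs.1; positivity
      rw [meanFR_eq (by omega) (hs.2.trans (Nat.floor_le_floor hNR))]
      split_ifs
      · rw [abs_of_nonneg (by positivity)]
        exact le_of_eq (by field_simp)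
      · simp
    · rw [div_le_one (by positivity)]
      exact abs_meanFR_le R (by omega) a
  calc _ = ∑ s ∈ Icc 1 (⌊N⌋₊ + 1), |meanFR R s a|
        + |(a : ℝ)| * ∑ s ∈ Icc 1 (⌊N⌋₊ + 1), |meanFR R s a| / s := by
        rw [mul_sum, ← sum_add_distrib]
        exact sum_congr rfl fun s _ => by ring
    _ ≤ _ := by gcongr

/-- average of `ρ_R*` over large moduli when `N ≤ R`. -/
theorem rho_large_moduli_NleR :
    ∃ C : ℝ, 0 < C ∧ ∀ x N R : ℝ, 2 ≤ x → 1 ≤ N → N ≤ R → R ≤ x →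
      ∀ a : ℤ, a ≠ 0 → |(a : ℝ)| < x / N →
      |(∑ q ∈ Finset.Ioc ⌊x / N⌋₊ ⌊x⌋₊, rhoStar R x q a)
          - x * ∑ s ∈ (Finset.Icc 1 ⌊N⌋₊).filter (fun s : ℕ => Int.gcd (s : ℤ) a = 1),
              (1 / (Nat.totient s : ℝ)) * (1 - (s : ℝ) / N)|
        ≤ C * (R * N + |(a : ℝ)| * Real.log (2 * N)) := by
  obtain ⟨C₁, hC₁, hphi⟩ := exists_sum_one_div_totient_le
  obtain ⟨C₂, hC₂, hsigma⟩ := exists_sum_sigma_div_totient_le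
  refine ⟨2 * C₂ + 4 + C₁ + 2, by positivity, fun x N R hx hN hNR _ a _ ha => ?_⟩
  have hx0 : 0 < x := by linarith
  have hR : 0 ≤ R := by linarith
  have hlog : 1 ≤ 2 * Real.log (2 * N) := by
    have := Real.log_le_log (by norm_num : (0 : ℝ) < 2) (by linarith : 2 ≤ 2 * N)
    linarith [Real.log_two_gt_d9]
  rw [sum_rhoStar_eq R hx0 hN ha, mul_sum_one_sub_div_eq a hx0 hN hNR, ← sum_sub_distrib]
  have hterm : ∀ s ∈ Icc 1 (⌊N⌋₊ + 1),
      |∑ q ∈ Ioc ⌊x / N⌋₊ ⌊min x ((x - a) / s)⌋₊, FR R (a + (s : ℤ) * (q : ℤ))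
        - max (x / s - x / N) 0 * meanFR R s a|
      ≤ C₂ * R + (1 + |(a : ℝ)| / s) * |meanFR R s a| := by
    intro s hs
    refine (abs_sub_le _ (((⌊min x ((x - a) / s)⌋₊ - ⌊x / N⌋₊ : ℕ) : ℝ) * meanFR R s a) _).trans ?_
    refine add_le_add ((abs_sum_FR_sub_le R s a _ _).trans (hsigma R hR)) ?_
    rw [← sub_mul, abs_mul]
    gcongr
    exact abs_length_sub_le hx0 hN ha (mem_Icc.1 hs).1
  have hfl : (⌊N⌋₊ : ℝ) ≤ N := Nat.floor_le (by linarith)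
  have hRN : 0 ≤ R * N := by positivity
  have hal : 0 ≤ |(a : ℝ)| * Real.log (2 * N) := mul_nonneg (abs_nonneg _) (by linarith)
  calc _ ≤ ∑ s ∈ Icc 1 (⌊N⌋₊ + 1), (C₂ * R + (1 + |(a : ℝ)| / s) * |meanFR R s a|) :=
        (abs_sum_le_sum_abs _ _).trans (sum_le_sum hterm)
    _ = ((⌊N⌋₊ : ℝ) + 1) * (C₂ * R)
        + ∑ s ∈ Icc 1 (⌊N⌋₊ + 1), (1 + |(a : ℝ)| / s) * |meanFR R s a| := by
        rw [sum_add_distrib]; simp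
    _ ≤ (2 * N) * (C₂ * R) + (4 * (R * N) + |(a : ℝ)| * (C₁ * Real.log (2 * N) + 1)) := by
        gcongr
        · linarith
        · exact sum_error_mul_abs_meanFR_le a hN hNR (hphi N hN)
    _ ≤ (2 * N) * (C₂ * R) + (4 * (R * N)
        + |(a : ℝ)| * (C₁ * Real.log (2 * N) + 2 * Real.log (2 * N))) := by gcongr
    _ ≤ (2 * C₂ + 4 + C₁ + 2) * (R * N + |(a : ℝ)| * Real.log (2 * N)) := by
        have h1 := mul_nonneg hC₁.le hRN
        have h2 := mul_nonneg hC₂.le hal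
        linarith
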